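/- Asymptotic localization of the superlevel set: with Φ_n as above and r = r(c) = √((4d²−2d)(c−1) log(c/(c−1))), every sequence A_n ∈ Φ_n satisfies ‖A_n‖ ≤ r + O(1/√n); moreover Φ_n is contained in the hyperplane {x ∈ ℝ^{2d} : Σ x_i = 0}, and adjacent points of Φ_n are at Euclidean distance 2d/√n. -/

import Mathlib

open Finset Real

/-- Multinomial coefficient with integer arguments, interpreted as `0`
whenever some argument is negative. -/
def mcoef {ℓ : ℕ} (k : Fin ℓ → ℤ) : ℕ :=
  if ∀ i, 0 ≤ k i then Nat.multinomial Finset.univ (fun i => (k i).toNat) else 0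

/-- The Radon–Nikodym derivative
`f(λ, N, n) = (2d)^n C(N-n; K-λ_1,…,K-λ_{2d}) / C(N; K,…,K)`, `N = 2dK`. -/
noncomputable def rnDeriv (d K n : ℕ) (lam : Fin (2*d) → ℕ) : ℝ :=
  (2*d : ℝ)^n * (mcoef (fun ℓ => (K : ℤ) - (lam ℓ : ℤ)) : ℝ)
    / (Nat.multinomial Finset.univ (fun _ : Fin (2*d) => K) : ℝ)

/-- The superlevel set `Φ_n` of the likelihood ratio, in rescaled coordinates
`λ_i = (n + a^i √n)/(2d)`. -/
def Phi (d : ℕ) (K : ℕ → ℕ) (n : ℕ) : Set (Fin (2*d) → ℝ) :=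
  {A | ∃ lam : Fin (2*d) → ℕ,
    (∀ i, (lam i : ℝ) = ((n : ℝ) + A i * Real.sqrt n) / (2*d)) ∧
    (∑ i, lam i = n) ∧ 1 ≤ rnDeriv d (K n) n lam}

/-- Upper half of Stirling's formula with an explicit error term. -/
theorem log_factorial_le_stirling {n : ℕ} (hn : n ≠ 0) :
    Real.log (n.factorial) ≤ n * Real.log n - n + Real.log n / 2 + Real.log (2 * π) / 2 + 1 / n := by
  let g : ℕ → ℝ := fun k => Real.log (Stirling.stirlingSeq (k + 1)) - 1 / (12 * ((k : ℝ) + 1))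
  have hmono : Monotone g := by
    refine monotone_nat_of_le_succ fun k => ?_
    have h := Stirling.log_stirlingSeq_sdiff_le (k + 1)
    have hk : (1 : ℝ) / (12 * ((k : ℝ) + 1)) - 1 / (12 * ((k : ℝ) + 1 + 1))
        = 1 / (12 * ((k : ℝ) + 1) * ((k : ℝ) + 1 + 1)) := by
      field_simp
      ring
    simp only [g]
    push_cast at h ⊢
    linarith
  have hlim : Filter.Tendsto g Filter.atTop (nhds (Real.log (√π) - 0)) := by
    refine Filter.Tendsto.sub ?_ ?_
    · have h := (Real.continuousAt_log (x := √π) (by positivity)).tendsto.comp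
        (Stirling.tendsto_stirlingSeq_sqrt_pi.comp (Filter.tendsto_add_atTop_nat 1))
      exact h
    · have h := (tendsto_one_div_add_atTop_nhds_zero_nat (𝕜 := ℝ)).const_mul (1 / 12)
      refine (h.congr fun k => ?_).trans (by simp)
      field_simp
  obtain ⟨k, rfl⟩ := Nat.exists_eq_succ_of_ne_zero hn
  have h := hmono.ge_of_tendsto hlim k
  simp only [g] at h
  rw [Stirling.log_stirlingSeq_formula, Real.log_sqrt pi_pos.le,
    Real.log_mul (by norm_num) (by positivity), Real.log_div (by positivity) (exp_ne_zero 1),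
    Real.log_exp] at h
  rw [Real.log_mul (x := 2) (by norm_num) pi_ne_zero]
  have h12 : (1 : ℝ) / (12 * ((k : ℝ) + 1)) ≤ 1 / ((k : ℝ) + 1) := by
    gcongr
    linarith [Nat.cast_nonneg (α := ℝ) k]
  push_cast at h ⊢
  linarith

theorem mul_log_sub_le_log_factorial (n : ℕ) : n * Real.log n - n ≤ Real.log (n.factorial) := by
  rcases Nat.eq_zero_or_pos n with rfl | hn
  · simp
  have h := Stirling.le_log_factorial_stirling hn.ne'
  have h1 : 0 ≤ Real.log n := Real.log_natCast_nonneg n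
  have h2 : 0 ≤ Real.log (2 * π) := Real.log_nonneg (by linarith [pi_gt_three])
  linarith

/-- A Bernstein type lower bound for the relative entropy function. -/
theorem sq_div_le_mul_log_sub {u : ℝ} (hu : -1 ≤ u) :
    u ^ 2 / (2 + |u|) ≤ (1 + u) * Real.log (1 + u) - u := by
  rcases le_or_gt 0 u with h | h
  · have h1 := mul_le_mul_of_nonneg_left (Real.le_log_one_add_of_nonneg h)
      (by linarith : 0 ≤ 1 + u)
    rw [abs_of_nonneg h]
    have h2 : (1 + u) * (2 * u / (u + 2)) - u = u ^ 2 / (2 + u) := by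
      field_simp
      ring
    linarith
  · have h2 : u ^ 2 / (2 + |u|) ≤ u ^ 2 / 2 := by
      gcongr
      linarith [abs_nonneg u]
    refine h2.trans ?_
    rcases hu.eq_or_lt with rfl | hu
    · norm_num
    have hx : 0 < 1 + u := by linarith
    have h3 : Real.sinh (Real.log (1 + u)) ≤ Real.log (1 + u) :=
      Real.sinh_le_self_iff.2 (Real.log_nonpos hx.le (by linarith))
    rw [Real.sinh_log hx] at h3
    have h4 := mul_le_mul_of_nonneg_left h3 hx.le
    have h5 : (1 + u) * (((1 + u) - (1 + u)⁻¹) / 2) = ((1 + u) ^ 2 - 1) / 2 := by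
      field_simp
    nlinarith

theorem sub_sq_le_log_one_add {u : ℝ} (hu : |u| ≤ 1 / 2) : u - u ^ 2 ≤ Real.log (1 + u) := by
  have hb := abs_le.1 hu
  have hx : 0 < 1 + u := by linarith
  rcases le_or_gt 0 u with h | h
  · refine le_trans ?_ (Real.one_sub_inv_le_log_of_pos hx)
    have h2 : 1 - (1 + u)⁻¹ = u / (1 + u) := by
      field_simp
      ring
    rw [h2, le_div_iff₀ hx]
    nlinarith [pow_nonneg h 3]
  · have h3 : Real.sinh (Real.log (1 + u)) ≤ Real.log (1 + u) :=
      Real.sinh_le_self_iff.2 (Real.log_nonpos hx.le (by linarith))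
    rw [Real.sinh_log hx] at h3
    refine le_trans ?_ h3
    have h2 : ((1 + u) - (1 + u)⁻¹) / 2 = ((1 + u) ^ 2 - 1) / 2 / (1 + u) := by
      field_simp
    rw [h2, le_div_iff₀ hx]
    nlinarith [mul_nonneg (sq_nonneg u) (by linarith : 0 ≤ 1 + 2 * u)]

/-- The defect between the leading terms of Stirling's formula for the two multinomial
coefficients is a relative entropy. -/
theorem entropy_identity {D : ℕ} {x u : Fin D → ℝ} {K n μ : ℝ} (hD : 0 < D) (hμ : 0 < μ)
    (hK : 0 < K) (hKn : D * μ + n = D * K) (hx : ∀ i, x i = μ * (1 + u i))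
    (hu : ∑ i, u i = 0) :
    n * Real.log D + (D * μ * Real.log (D * μ) - D * μ) + D * (K * Real.log K - K)
      - (D * K * Real.log (D * K) - D * K) - ∑ i, (x i * Real.log (x i) - x i)
      = -(μ * ∑ i, ((1 + u i) * Real.log (1 + u i) - u i)) := by
  have hD' : (0 : ℝ) < D := by exact_mod_cast hD
  have hterm : ∀ i, x i * Real.log (x i) - x i
      = μ * ((1 + u i) * Real.log (1 + u i) - u i) + (μ * Real.log μ) * (1 + u i) - μ := by
    intro i
    rw [hx i]
    rcases eq_or_ne (1 + u i) 0 with h | h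
    · rw [h]
      have : u i = -1 := by linarith
      simp [this]
    · rw [Real.log_mul hμ.ne' h]
      ring
  simp_rw [hterm]
  rw [Finset.sum_sub_distrib, Finset.sum_add_distrib, ← Finset.mul_sum, ← Finset.mul_sum,
    Finset.sum_add_distrib, hu, Real.log_mul hD'.ne' hμ.ne', Real.log_mul hD'.ne' hK.ne']
  simp only [Finset.sum_const, Finset.card_univ, Fintype.card_fin, nsmul_eq_mul]
  have hn : n = D * K - D * μ := by linarith
  rw [hn]
  ring

theorem log_factorial_le_of_multinomial_le {D K n : ℕ} (hD : 0 < D) (x : Fin D → ℕ)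
    (h : (Nat.multinomial Finset.univ (fun _ : Fin D => K) : ℝ)
      ≤ (D : ℝ) ^ n * Nat.multinomial Finset.univ x) :
    (∑ i, Real.log ((x i).factorial)) + Real.log ((D * K).factorial)
      ≤ n * Real.log D + Real.log ((∑ i, x i).factorial) + D * Real.log (K.factorial) := by
  have hD' : (0 : ℝ) < D := by exact_mod_cast hD
  have e1 := Nat.multinomial_spec Finset.univ x
  have e2 := Nat.multinomial_spec Finset.univ (fun _ : Fin D => K)
  have p1 : 0 < Nat.multinomial Finset.univ x := Nat.multinomial_pos _ _
  have p2 : 0 < Nat.multinomial Finset.univ (fun _ : Fin D => K) := Nat.multinomial_pos _ _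
  simp only [Finset.prod_const, Finset.sum_const, Finset.card_univ, Fintype.card_fin,
    smul_eq_mul] at e2
  have hfac : ∀ m : ℕ, ((m.factorial : ℕ) : ℝ) ≠ 0 := fun m => by
    exact_mod_cast m.factorial_ne_zero
  have l1 : (∑ i, Real.log ((x i).factorial)) + Real.log (Nat.multinomial Finset.univ x)
      = Real.log ((∑ i, x i).factorial) := by
    rw [← e1, Nat.cast_mul, Nat.cast_prod, Real.log_mul (Finset.prod_ne_zero_iff.2
      fun i _ => hfac _) (by exact_mod_cast p1.ne'), Real.log_prod fun i _ => hfac _]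
  have l2 : D * Real.log (K.factorial)
      + Real.log (Nat.multinomial Finset.univ (fun _ : Fin D => K))
      = Real.log ((D * K).factorial) := by
    rw [← e2, Nat.cast_mul, Nat.cast_pow, Real.log_mul (pow_ne_zero _ (hfac _))
      (by exact_mod_cast p2.ne'), Real.log_pow]
  have l3 := Real.log_le_log (by exact_mod_cast p2) h
  rw [Real.log_mul (by positivity) (by exact_mod_cast p1.ne'), Real.log_pow] at l3
  linarith

section Entropy

variable {D K n : ℕ} {x : Fin D → ℕ} {u : Fin D → ℝ} {μ : ℝ}

theorem stirling_upper_le (hD : 0 < D) (hμ : 0 < μ) (hKμ : μ ≤ K)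
    (hM : ((∑ i, x i : ℕ) : ℝ) = D * μ) :
    n * Real.log D + Real.log ((∑ i, x i).factorial) + D * Real.log (K.factorial)
      - Real.log ((D * K).factorial)
    ≤ n * Real.log D + (D * μ * Real.log (D * μ) - D * μ) + D * (K * Real.log K - K)
      - (D * K * Real.log (D * K) - D * K) + ((D : ℝ) - 1) / 2 * Real.log (K / μ)
      + D / 2 * Real.log (2 * π) + D / 2 * Real.log μ + (1 / (D * μ) + D / K) := by
  have hD' : (0 : ℝ) < D := by exact_mod_cast hD
  have hK : (0 : ℝ) < K := hμ.trans_le hKμ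
  have hKne : K ≠ 0 := by exact_mod_cast hK.ne'
  have hMne : (∑ i, x i) ≠ 0 := by
    have : (0 : ℝ) < ((∑ i, x i : ℕ) : ℝ) := by rw [hM]; positivity
    exact_mod_cast this.ne'
  have h1 := log_factorial_le_stirling hMne
  have h2 := mul_le_mul_of_nonneg_left (log_factorial_le_stirling hKne) hD'.le
  have h3 := Stirling.le_log_factorial_stirling (Nat.mul_ne_zero hD.ne' hKne)
  rw [hM] at h1
  push_cast at h3
  rw [Real.log_div hK.ne' hμ.ne']
  rw [Real.log_mul hD'.ne' hμ.ne'] at h1 ⊢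
  rw [Real.log_mul hD'.ne' hK.ne'] at h3 ⊢
  have h4 : (D : ℝ) / K = D * (1 / K) := by ring
  rw [h4]
  linarith

theorem entropy_le_crude (hD : 0 < D) (hμ : 0 < μ) (hKμ : μ ≤ K)
    (hM : ((∑ i, x i : ℕ) : ℝ) = D * μ) (hKn : (D : ℝ) * μ + n = D * K)
    (hx : ∀ i, (x i : ℝ) = μ * (1 + u i)) (hu : ∑ i, u i = 0)
    (h : (∑ i, Real.log ((x i).factorial)) + Real.log ((D * K).factorial)
      ≤ n * Real.log D + Real.log ((∑ i, x i).factorial) + D * Real.log (K.factorial)) :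
    μ * ∑ i, ((1 + u i) * Real.log (1 + u i) - u i)
      ≤ ((D : ℝ) - 1) / 2 * Real.log (K / μ) + D / 2 * Real.log (2 * π * μ) + (1 + D) := by
  have hD' : (0 : ℝ) < D := by exact_mod_cast hD
  have hK : (0 : ℝ) < K := hμ.trans_le hKμ
  have hK1 : (1 : ℝ) ≤ K := by exact_mod_cast (Nat.cast_pos.1 hK)
  have hM1 : (1 : ℝ) ≤ D * μ := by
    have : (0 : ℝ) < ((∑ i, x i : ℕ) : ℝ) := by rw [hM]; positivity
    rw [← hM]
    exact_mod_cast (Nat.cast_pos.1 this)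
  have h1 := stirling_upper_le (n := n) hD hμ hKμ hM
  have h2 := entropy_identity (x := fun i => (x i : ℝ)) hD hμ hK hKn hx hu
  have h3 : ∑ i, ((x i : ℝ) * Real.log (x i) - x i) ≤ ∑ i, Real.log ((x i).factorial) :=
    Finset.sum_le_sum fun i _ => mul_log_sub_le_log_factorial (x i)
  have h4 : 1 / (D * μ) ≤ 1 := (div_le_one (by positivity)).2 hM1
  have h5 : (D : ℝ) / K ≤ D := div_le_self hD'.le hK1
  rw [Real.log_mul (by positivity) hμ.ne']
  linarith

theorem entropy_le_fine (hD : 0 < D) (hμ : 0 < μ) (hKμ : μ ≤ K)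
    (hM : ((∑ i, x i : ℕ) : ℝ) = D * μ) (hKn : (D : ℝ) * μ + n = D * K)
    (hx : ∀ i, (x i : ℝ) = μ * (1 + u i)) (hu : ∑ i, u i = 0) (hpos : ∀ i, -1 < u i)
    (h : (∑ i, Real.log ((x i).factorial)) + Real.log ((D * K).factorial)
      ≤ n * Real.log D + Real.log ((∑ i, x i).factorial) + D * Real.log (K.factorial)) :
    μ * ∑ i, ((1 + u i) * Real.log (1 + u i) - u i)
      ≤ ((D : ℝ) - 1) / 2 * Real.log (K / μ) - (∑ i, Real.log (1 + u i)) / 2 + (1 + D) / μ := by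
  have hD' : (1 : ℝ) ≤ D := by exact_mod_cast hD
  have hK : (0 : ℝ) < K := hμ.trans_le hKμ
  have h1 := stirling_upper_le (n := n) hD hμ hKμ hM
  have h2 := entropy_identity (x := fun i => (x i : ℝ)) hD hμ hK hKn hx hu
  have h3 : ∑ i, (((x i : ℝ) * Real.log (x i) - x i)
      + ((Real.log μ + Real.log (2 * π)) / 2 + Real.log (1 + u i) / 2))
      ≤ ∑ i, Real.log ((x i).factorial) := by
    refine Finset.sum_le_sum fun i _ => ?_
    have hp : 0 < 1 + u i := by linarith [hpos i]
    have hxi : x i ≠ 0 := by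
      have : (0 : ℝ) < x i := by rw [hx i]; positivity
      exact_mod_cast this.ne'
    have h6 := Stirling.le_log_factorial_stirling hxi
    have h7 : Real.log (x i) = Real.log μ + Real.log (1 + u i) := by
      rw [hx i, Real.log_mul hμ.ne' hp.ne']
    linarith
  rw [Finset.sum_add_distrib, Finset.sum_add_distrib] at h3
  simp only [Finset.sum_const, Finset.card_univ, Fintype.card_fin, nsmul_eq_mul] at h3
  rw [← Finset.sum_div] at h3
  have h4 : 1 / (D * μ) ≤ 1 / μ := by
    gcongr
    nlinarith
  have h5 : (D : ℝ) / K ≤ D / μ := by gcongr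
  rw [add_div]
  linarith

end Entropy

/-- The entropy bounds force the chi-square statistic to be at most `2 L`, up to `O(1/√μ)`. -/
theorem chi_sq_le_of_entropy_le {D : ℕ} (hD : 0 < D) {L E : ℝ} (hL : 0 ≤ L) (hE : 0 ≤ E) :
    ∃ C > (0 : ℝ), ∀ (μ : ℝ) (u : Fin D → ℝ), 0 < μ → (∀ i, -1 ≤ u i) → (∀ i, |u i| ≤ D) →
      ∑ i, u i = 0 →
      μ * ∑ i, ((1 + u i) * Real.log (1 + u i) - u i) ≤ L + D / 2 * Real.log (2 * π * μ) + E →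
      ((∀ i, -1 < u i) → μ * ∑ i, ((1 + u i) * Real.log (1 + u i) - u i)
        ≤ L - (∑ i, Real.log (1 + u i)) / 2 + E / μ) →
      μ * ∑ i, u i ^ 2 ≤ 2 * L + C / √μ := by
  have hD' : (1 : ℝ) ≤ D := by exact_mod_cast hD
  set ε : ℝ := 1 / (4 * D * (2 + D)) with hε
  have hεpos : 0 < ε := by positivity
  set C₁ : ℝ := max (8 * (2 + D) * (L + E + D / 2 * Real.log (2 * π / ε))) (5 / 2) with hC₁
  have hC₁' : 5 / 2 ≤ C₁ := le_max_right _ _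
  set C₂ : ℝ := 5 * (L + E) with hC₂
  have hC₂' : 0 ≤ C₂ := by positivity
  refine ⟨C₁ * D ^ 3 * (C₁ + 1) + (2 * E + C₂ * √C₂ / 2 + C₂), by positivity, ?_⟩
  intro μ u hμ hu1 huD hsum hI hII
  have hsqrt : 0 < √μ := Real.sqrt_pos.2 hμ
  have hss : √μ * √μ = μ := Real.mul_self_sqrt hμ.le
  have hφ : ∑ i, u i ^ 2 / (2 + |u i|) ≤ ∑ i, ((1 + u i) * Real.log (1 + u i) - u i) :=
    Finset.sum_le_sum fun i _ => sq_div_le_mul_log_sub (hu1 i)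
  have hφμ := mul_le_mul_of_nonneg_left hφ hμ.le
  have hsq : ∀ i, u i ^ 2 ≤ ∑ j, u j ^ 2 := fun i =>
    Finset.single_le_sum (f := fun j => u j ^ 2) (fun j _ => sq_nonneg _) (Finset.mem_univ i)
  have hS0 : 0 ≤ ∑ i, u i ^ 2 := Finset.sum_nonneg fun i _ => sq_nonneg _
  rw [add_div]
  rcases le_or_gt μ C₁ with hcase | hcase
  · have h1 : ∑ i, u i ^ 2 ≤ ∑ _i : Fin D, (D : ℝ) ^ 2 := by
      refine Finset.sum_le_sum fun i _ => ?_
      rw [← sq_abs]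
      exact pow_le_pow_left₀ (abs_nonneg _) (huD i) 2
    simp only [Finset.sum_const, Finset.card_univ, Fintype.card_fin, nsmul_eq_mul] at h1
    have h2 : μ * ∑ i, u i ^ 2 ≤ C₁ * (D * D ^ 2) := by gcongr
    have h3 : √μ ≤ C₁ + 1 := by nlinarith [sq_nonneg (√μ - 1)]
    have h4 : C₁ * (D : ℝ) ^ 3 ≤ C₁ * D ^ 3 * (C₁ + 1) / √μ := by
      rw [le_div_iff₀ hsqrt]
      gcongr
    have h5 : 0 ≤ (2 * E + C₂ * √C₂ / 2 + C₂) / √μ := by positivity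
    nlinarith
  have hsmall : ∀ i, |u i| ≤ 1 / 2 := by
    intro i
    by_contra! hi
    have h1 : u i ^ 2 / (2 + |u i|) ≤ ∑ j, u j ^ 2 / (2 + |u j|) :=
      Finset.single_le_sum (f := fun j => u j ^ 2 / (2 + |u j|))
        (fun j _ => by positivity) (Finset.mem_univ i)
    have h2 : 1 / 4 / (2 + (D : ℝ)) ≤ u i ^ 2 / (2 + |u i|) := by
      have := huD i
      gcongr
      rw [← sq_abs]
      nlinarith
    have h3 : Real.log (2 * π * μ) ≤ ε * μ + Real.log (2 * π / ε) := by
      have e : 2 * π * μ = (ε * μ) * (2 * π / ε) := by field_simp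
      rw [e, Real.log_mul (by positivity) (by positivity)]
      linarith [Real.log_le_sub_one_of_pos (mul_pos hεpos hμ)]
    have h4 := mul_le_mul_of_nonneg_left (h2.trans h1) hμ.le
    have h5 := mul_le_mul_of_nonneg_left h3 (by positivity : (0 : ℝ) ≤ D / 2)
    have h6 : (D : ℝ) / 2 * (ε * μ) = μ * (1 / 4 / (2 + (D : ℝ))) / 2 := by
      rw [hε]
      field_simp
    have h7 : μ * (1 / 4 / (2 + (D : ℝ))) / 2 ≤ L + E + D / 2 * Real.log (2 * π / ε) := by
      linarith
    have h8 : μ = 8 * (2 + D) * (μ * (1 / 4 / (2 + (D : ℝ))) / 2) := by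
      field_simp
      norm_num
    have h9 : μ ≤ 8 * (2 + D) * (L + E + D / 2 * Real.log (2 * π / ε)) := by
      rw [h8]
      gcongr
    exact absurd (h9.trans (le_max_left _ _)) (not_le.2 hcase)
  have hII' := hII fun i => by linarith [(abs_le.1 (hsmall i)).1]
  have hlog : -∑ i, u i ^ 2 ≤ ∑ i, Real.log (1 + u i) := by
    have h := Finset.sum_le_sum fun i (_ : i ∈ Finset.univ) => sub_sq_le_log_one_add (hsmall i)
    rw [Finset.sum_sub_distrib, hsum] at h
    linarith
  have hEμ : E / μ ≤ E := div_le_self hE (by linarith)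
  have hS2 : μ * ∑ i, u i ^ 2 ≤ C₂ := by
    have h1 : (∑ i, u i ^ 2) * (2 / 5) ≤ ∑ i, u i ^ 2 / (2 + |u i|) := by
      rw [Finset.sum_mul]
      refine Finset.sum_le_sum fun i _ => ?_
      rw [le_div_iff₀ (by positivity)]
      nlinarith [hsmall i, sq_nonneg (u i)]
    have h2 := mul_le_mul_of_nonneg_left h1 hμ.le
    nlinarith
  have hus : ∀ i, |u i| ≤ √C₂ / √μ := by
    intro i
    rw [← Real.sqrt_div hC₂']
    apply Real.abs_le_sqrt
    rw [le_div_iff₀ hμ]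
    nlinarith [hsq i]
  have h1 : (∑ i, u i ^ 2) * (1 / 2 - √C₂ / √μ / 4) ≤ ∑ i, u i ^ 2 / (2 + |u i|) := by
    rw [Finset.sum_mul]
    refine Finset.sum_le_sum fun i _ => ?_
    have ha : u i ^ 2 * (1 / 2 - √C₂ / √μ / 4) ≤ u i ^ 2 * (1 / 2 - |u i| / 4) := by
      have := hus i
      gcongr
    refine ha.trans ?_
    rw [le_div_iff₀ (by positivity)]
    nlinarith [mul_nonneg (sq_nonneg (u i)) (sq_nonneg |u i|)]
  have h2 := mul_le_mul_of_nonneg_left h1 hμ.le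
  have hinv : 1 / μ ≤ 1 / √μ := by
    gcongr
    nlinarith
  have h3 : E / μ ≤ E / √μ := by
    have := mul_le_mul_of_nonneg_left hinv hE
    rwa [mul_one_div, mul_one_div] at this
  have h4 : ∑ i, u i ^ 2 ≤ C₂ / √μ := by
    have : ∑ i, u i ^ 2 ≤ C₂ / μ := by
      rw [le_div_iff₀ hμ]
      linarith
    have h := mul_le_mul_of_nonneg_left hinv hC₂'
    rw [mul_one_div, mul_one_div] at h
    linarith
  have h5 : (μ * ∑ i, u i ^ 2) * (√C₂ / √μ) ≤ C₂ * (√C₂ / √μ) := by gcongr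
  have h6 : 0 ≤ C₁ * (D : ℝ) ^ 3 * (C₁ + 1) / √μ := by positivity
  have h7 : (2 * E + C₂ * √C₂ / 2 + C₂) / √μ
      = 2 * (E / √μ) + C₂ * (√C₂ / √μ) / 2 + C₂ / √μ := by ring
  rw [h7]
  nlinarith

theorem sqrt_add_le {a b : ℝ} (ha : 0 < a) (hb : 0 ≤ b) : √(a + b) ≤ √a + b / (2 * √a) := by
  have h : 0 < √a := Real.sqrt_pos.2 ha
  refine Real.sqrt_le_iff.2 ⟨by positivity, ?_⟩
  have e : (√a + b / (2 * √a)) ^ 2 = √a ^ 2 + b + (b / (2 * √a)) ^ 2 := by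
    field_simp
    ring
  rw [e, Real.sq_sqrt ha.le]
  nlinarith [sq_nonneg (b / (2 * √a))]

theorem multinomial_le_of_one_le_rnDeriv {d K n : ℕ} {lam : Fin (2 * d) → ℕ}
    (hle : ∀ i, lam i ≤ K) (h : 1 ≤ rnDeriv d K n lam) :
    (Nat.multinomial Finset.univ (fun _ : Fin (2 * d) => K) : ℝ)
      ≤ ((2 * d : ℕ) : ℝ) ^ n * Nat.multinomial Finset.univ (fun i => K - lam i) := by
  have hm : mcoef (fun i => (K : ℤ) - (lam i : ℤ))
      = Nat.multinomial Finset.univ (fun i => K - lam i) := by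
    rw [mcoef, if_pos fun i => by have := hle i; omega]
    exact Nat.multinomial_congr fun i _ => by have := hle i; omega
  have hp : (0 : ℝ) < Nat.multinomial Finset.univ (fun _ : Fin (2 * d) => K) := by
    exact_mod_cast Nat.multinomial_pos _ _
  rw [rnDeriv, hm, one_le_div hp] at h
  push_cast
  exact h

/-- The squared norm bound for points of `Phi`. -/
theorem exists_sum_sq_le_of_mem_Phi {d : ℕ} (hd : 0 < d) {c : ℝ} (hc : 2 * d ≤ c) {K : ℕ → ℕ}
    (hK : ∀ n : ℕ, ((2 * d * K n : ℕ) : ℝ) = c * n) :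
    ∃ C > (0 : ℝ), ∀ n : ℕ, 1 ≤ n → ∀ A ∈ Phi d K n, ∑ i, A i = 0 →
      ∑ i, A i ^ 2 ≤ (4 * (d : ℝ) ^ 2 - 2 * d) * (c - 1) * Real.log (c / (c - 1)) + C / √n := by
  have hd1 : (1 : ℝ) ≤ d := by exact_mod_cast hd
  have hc1 : 0 < c - 1 := by linarith
  have hlogpos : 0 < Real.log (c / (c - 1)) :=
    Real.log_pos ((one_lt_div hc1).2 (by linarith))
  have hD : 0 < 2 * d := by omega
  have hDc : ((2 * d : ℕ) : ℝ) = 2 * (d : ℝ) := by push_cast; ring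
  set L : ℝ := (((2 * d : ℕ) : ℝ) - 1) / 2 * Real.log (c / (c - 1)) with hL
  have hL0 : 0 ≤ L := mul_nonneg (by rw [hDc]; linarith) hlogpos.le
  obtain ⟨C, hC, hchi⟩ := chi_sq_le_of_entropy_le hD hL0
    (by positivity : (0 : ℝ) ≤ 1 + ((2 * d : ℕ) : ℝ))
  refine ⟨2 * d * (c - 1) * (C / √((c - 1) / (2 * d))), by positivity, ?_⟩
  rintro n hn A ⟨lam, hlam, hsum, hf⟩ hA
  have hn0 : (0 : ℝ) < n := by exact_mod_cast hn
  have hsn : 0 < √(n : ℝ) := Real.sqrt_pos.2 hn0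
  have hsn2 : √(n : ℝ) ^ 2 = n := Real.sq_sqrt hn0.le
  have hKc : 2 * (d : ℝ) * K n = c * n := by
    rw [← hK n]
    push_cast
    ring
  have hnK : n ≤ K n := by
    have h : 2 * (d : ℝ) * n ≤ 2 * d * K n := by
      rw [hKc]
      gcongr
    exact_mod_cast le_of_mul_le_mul_left h (by positivity)
  have hle : ∀ i, lam i ≤ K n := fun i =>
    ((Finset.single_le_sum (fun j _ => Nat.zero_le (lam j)) (Finset.mem_univ i)).trans
      hsum.le).trans hnK
  set μ : ℝ := (c - 1) * n / (2 * d) with hμdef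
  have hμ : 0 < μ := by positivity
  have hDμ : ((2 * d : ℕ) : ℝ) * μ = (c - 1) * n := by
    rw [hDc, hμdef]
    field_simp
  let x : Fin (2 * d) → ℕ := fun i => K n - lam i
  let u : Fin (2 * d) → ℝ := fun i => -(A i * √n) / ((c - 1) * n)
  have hx : ∀ i, (x i : ℝ) = μ * (1 + u i) := by
    intro i
    simp only [x, u]
    rw [Nat.cast_sub (hle i), hlam i, hμdef, eq_div_of_mul_eq (by positivity)
      ((mul_comm _ _).trans hKc)]
    field_simp
    ring
  have hu : ∑ i, u i = 0 := by
    simp only [u]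
    rw [← Finset.sum_div, Finset.sum_neg_distrib, ← Finset.sum_mul, hA]
    simp
  have hM : ((∑ i, x i : ℕ) : ℝ) = ((2 * d : ℕ) : ℝ) * μ := by
    push_cast
    simp_rw [hx]
    rw [← Finset.mul_sum, Finset.sum_add_distrib, hu]
    simp only [Finset.sum_const, Finset.card_univ, Fintype.card_fin, nsmul_eq_mul]
    push_cast
    ring
  have hKn : ((2 * d : ℕ) : ℝ) * μ + n = ((2 * d : ℕ) : ℝ) * K n := by
    rw [hDμ, hDc, hKc]
    ring
  have hKμ : μ ≤ K n := by
    have h : ((2 * d : ℕ) : ℝ) * μ ≤ ((2 * d : ℕ) : ℝ) * K n := by linarith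
    exact le_of_mul_le_mul_left h (by rw [hDc]; positivity)
  have hratio : (K n : ℝ) / μ = c / (c - 1) := by
    rw [hμdef, eq_div_of_mul_eq (by positivity) ((mul_comm _ _).trans hKc)]
    field_simp
  have hlower : ∀ i, -1 ≤ u i := by
    intro i
    have h : 0 ≤ μ * (1 + u i) := by
      rw [← hx i]
      positivity
    linarith [nonneg_of_mul_nonneg_right h hμ]
  have hupper : ∀ i, |u i| ≤ ((2 * d : ℕ) : ℝ) := by
    intro i
    have h : (x i : ℝ) ≤ ((∑ j, x j : ℕ) : ℝ) := by
      exact_mod_cast Finset.single_le_sum (fun j _ => Nat.zero_le (x j)) (Finset.mem_univ i)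
    rw [hM, hx i, mul_comm] at h
    have h2 := le_of_mul_le_mul_right h hμ
    refine abs_le.2 ⟨?_, by linarith⟩
    have := hlower i
    rw [hDc]
    linarith
  have hlog := log_factorial_le_of_multinomial_le hD x (multinomial_le_of_one_le_rnDeriv hle hf)
  have hI := entropy_le_crude hD hμ hKμ hM hKn hx hu hlog
  rw [hratio] at hI
  have hS := hchi μ u hμ hlower hupper hu hI fun hpos => by
    have h := entropy_le_fine hD hμ hKμ hM hKn hx hu hpos hlog
    rwa [hratio] at h
  have hSA : 2 * d * (c - 1) * (μ * ∑ i, u i ^ 2) = ∑ i, A i ^ 2 := by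
    have hui : ∀ i, u i ^ 2 = A i ^ 2 * (1 / ((c - 1) ^ 2 * n)) := by
      intro i
      simp only [u]
      rw [div_pow, neg_sq, mul_pow, hsn2]
      field_simp
    simp_rw [hui]
    rw [← Finset.sum_mul, hμdef]
    field_simp
  have hsμ : √μ = √((c - 1) / (2 * d)) * √n := by
    rw [← Real.sqrt_mul (by positivity), hμdef]
    congr 1
    ring
  rw [← hSA]
  refine (mul_le_mul_of_nonneg_left hS (by positivity)).trans (le_of_eq ?_)
  rw [hsμ, hL, hDc, ← div_div]
  ring

/-- Asymptotic localization of `Φ_n`: every `A ∈ Φ_n` has Euclidean norm at most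
`r + O(1/√n)` with `r = √((4d²-2d)(c-1) log(c/(c-1)))`, lies in the hyperplane
`Σ aᵢ = 0`, and its coordinates lie in the lattice `(2dℤ - n)/√n`, so that
adjacent points of `Φ_n` differ by `2d/√n` in each changed coordinate. -/
theorem Phi_localization (d : ℕ) (hd : 0 < d) (c : ℝ) (hc : 2*d ≤ c)
    (K : ℕ → ℕ) (hK : ∀ n : ℕ, ((2*d*K n : ℕ) : ℝ) = c * n) :
    ∃ C₀ > (0:ℝ), ∀ n : ℕ, 1 ≤ n → ∀ A ∈ Phi d K n,
      (Real.sqrt (∑ i, (A i)^2)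
          ≤ Real.sqrt ((4*(d:ℝ)^2 - 2*d) * (c-1) * Real.log (c/(c-1))) + C₀ / Real.sqrt n)
      ∧ (∑ i, A i = 0)
      ∧ (∀ i, ∃ m : ℕ, A i = (2*(d:ℝ)*m - n) / Real.sqrt n)
      ∧ (∀ A' ∈ Phi d K n, ∀ i, A i ≠ A' i → 2*(d:ℝ) / Real.sqrt n ≤ |A i - A' i|) := by
  have hd1 : (1 : ℝ) ≤ d := by exact_mod_cast hd
  have hc1 : 0 < c - 1 := by linarith
  have hlogpos : 0 < Real.log (c / (c - 1)) :=
    Real.log_pos ((one_lt_div hc1).2 (by linarith))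
  set R : ℝ := (4 * (d : ℝ) ^ 2 - 2 * d) * (c - 1) * Real.log (c / (c - 1)) with hR
  have hRpos : 0 < R := mul_pos (mul_pos (by nlinarith) hc1) hlogpos
  obtain ⟨C, hC, hbound⟩ := exists_sum_sq_le_of_mem_Phi hd hc hK
  refine ⟨C / (2 * √R), by positivity, ?_⟩
  intro n hn A hAmem
  have hn0 : (0 : ℝ) < n := by exact_mod_cast hn
  have hsn : 0 < √(n : ℝ) := Real.sqrt_pos.2 hn0
  obtain ⟨lam, hlam, hsum, -⟩ := id hAmem
  have hA : ∀ i, A i = (2 * (d : ℝ) * lam i - n) / √n := by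
    intro i
    rw [hlam i]
    field_simp
    ring
  have hA0 : ∑ i, A i = 0 := by
    simp_rw [hA]
    rw [← Finset.sum_div, Finset.sum_sub_distrib, ← Finset.mul_sum, ← Nat.cast_sum, hsum]
    simp
  refine ⟨?_, hA0, fun i => ⟨lam i, hA i⟩, ?_⟩
  · refine (Real.sqrt_le_sqrt (hbound n hn A hAmem hA0)).trans
      ((sqrt_add_le hRpos (by positivity)).trans (le_of_eq ?_))
    rw [div_right_comm]
  · rintro A' ⟨lam', hlam', -, -⟩ i hne
    have hdiff : A i - A' i = 2 * (d : ℝ) / √n * (((lam i : ℤ) - (lam' i : ℤ) : ℤ) : ℝ) := by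
      have hA' : A' i = (2 * (d : ℝ) * lam' i - n) / √n := by
        rw [hlam' i]
        field_simp
        ring
      rw [hA i, hA']
      push_cast
      ring
    have hz : (lam i : ℤ) - (lam' i : ℤ) ≠ 0 := by
      intro h0
      rw [h0] at hdiff
      exact hne (by simpa [sub_eq_zero] using hdiff)
    have h1 : (1 : ℝ) ≤ |(((lam i : ℤ) - (lam' i : ℤ) : ℤ) : ℝ)| := by
      exact_mod_cast Int.one_le_abs hz
    rw [hdiff, abs_mul, abs_of_nonneg (by positivity : 0 ≤ 2 * (d : ℝ) / √n)]
    exact le_mul_of_one_le_right (by positivity) h1
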